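/- For every λ > 0 and every real z > λ + 2, the Cauchy transform of μ_{1,λ} satisfies ∫ 1/(z − x) dμ_{1,λ}(x) = (z + λ − √((z − λ)² − 4)) / (2(λz + 1)), where √ is the real square root. -/

import Mathlib

open MeasureTheory

-- Absolutely continuous part of `μ_{1,λ}`: density
-- `x ↦ √(4 − (x − λ)²)/(2π(λx + 1))` on `[λ − 2, λ + 2]`, `0` elsewhere.
open Classical in
noncomputable def muOneAC (lam : ℝ) : Measure ℝ :=
  volume.withDensity fun x =>
    ENNReal.ofReal (if x ∈ Set.Icc (lam - 2) (lam + 2) then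
      Real.sqrt (4 - (x - lam) ^ 2) / (2 * Real.pi * (lam * x + 1)) else 0)

-- `μ_{1,λ} = max(0, 1 − 1/λ²)·δ_{−1/λ} + μ^{ac}_{1,λ}`.
noncomputable def muOne (lam : ℝ) : Measure ℝ :=
  (ENNReal.ofReal (max 0 (1 - 1 / lam ^ 2))) • Measure.dirac (-(1 / lam)) + muOneAC lam

/-- On `(-2, 2)`, `√(4 - y²) / (w - y)` has an elementary primitive. -/
theorem hasDerivAt_primitive_sqrt_div_sub {w y : ℝ} (hw : 2 ≤ w) (hy : y ∈ Set.Ioo (-2 : ℝ) 2) :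
    HasDerivAt (fun y => w * Real.arcsin (y / 2) - Real.sqrt (4 - y ^ 2) -
      Real.sqrt (w ^ 2 - 4) * Real.arcsin ((w * y - 4) / (2 * (w - y))))
      (Real.sqrt (4 - y ^ 2) / (w - y)) y := by
  obtain ⟨hy1, hy2⟩ := hy
  have hpos : 0 < 4 - y ^ 2 := by nlinarith
  have hs : 0 < Real.sqrt (4 - y ^ 2) := Real.sqrt_pos.2 hpos
  have hs2 : Real.sqrt (4 - y ^ 2) ^ 2 = 4 - y ^ 2 := Real.sq_sqrt hpos.le
  have hwy : 0 < w - y := by linarith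
  have h1 : HasDerivAt (fun y : ℝ => Real.arcsin (y / 2)) (1 / Real.sqrt (4 - y ^ 2)) y := by
    have h := (Real.hasDerivAt_arcsin (x := y / 2) (by linarith) (by linarith)).comp y
      ((hasDerivAt_id y).div_const 2)
    refine h.congr_deriv ?_
    have : Real.sqrt (1 - (y / 2) ^ 2) = Real.sqrt (4 - y ^ 2) / 2 := by
      rw [show 1 - (y / 2) ^ 2 = (4 - y ^ 2) / 2 ^ 2 by ring, Real.sqrt_div hpos.le,
        Real.sqrt_sq (by norm_num)]
    rw [this]
    field_simp
  have h2 : HasDerivAt (fun y : ℝ => Real.sqrt (4 - y ^ 2)) (-y / Real.sqrt (4 - y ^ 2)) y := by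
    have h := (((hasDerivAt_id y).pow 2).const_sub 4).sqrt hpos.ne'
    refine h.congr_deriv ?_
    simp only [id, Pi.pow_apply]
    norm_num
    field_simp
  have h3 : HasDerivAt (fun y : ℝ => Real.sqrt (w ^ 2 - 4) *
      Real.arcsin ((w * y - 4) / (2 * (w - y))))
      ((w ^ 2 - 4) / ((w - y) * Real.sqrt (4 - y ^ 2))) y := by
    rcases hw.eq_or_lt with rfl | hw'
    · norm_num
      exact hasDerivAt_const _ _
    have hr : 0 < w ^ 2 - 4 := by nlinarith
    have hrs : 0 < Real.sqrt (w ^ 2 - 4) := Real.sqrt_pos.2 hr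
    have hu : HasDerivAt (fun y : ℝ => (w * y - 4) / (2 * (w - y)))
        ((w ^ 2 - 4) / (2 * (w - y) ^ 2)) y := by
      have h := (((hasDerivAt_id y).const_mul w).sub_const 4).div
        (((hasDerivAt_id y).const_sub w).const_mul 2) (by simpa using hwy.ne')
      refine h.congr_deriv ?_
      simp only [id]
      field_simp
      ring
    have hu1 : (w * y - 4) / (2 * (w - y)) ≠ -1 := by
      rw [Ne, div_eq_iff (by positivity)]
      nlinarith
    have hu2 : (w * y - 4) / (2 * (w - y)) ≠ 1 := by
      rw [Ne, div_eq_iff (by positivity)]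
      nlinarith
    have hsq : Real.sqrt (1 - ((w * y - 4) / (2 * (w - y))) ^ 2) =
        Real.sqrt (w ^ 2 - 4) * Real.sqrt (4 - y ^ 2) / (2 * (w - y)) := by
      rw [show 1 - ((w * y - 4) / (2 * (w - y))) ^ 2 =
          ((w ^ 2 - 4) * (4 - y ^ 2)) / (2 * (w - y)) ^ 2 by field_simp; ring,
        Real.sqrt_div (by positivity), Real.sqrt_sq (by positivity), Real.sqrt_mul hr.le]
    have h := ((Real.hasDerivAt_arcsin hu1 hu2).comp y hu).const_mul (Real.sqrt (w ^ 2 - 4))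
    refine h.congr_deriv ?_
    rw [hsq]
    field_simp
  refine (((h1.const_mul w).sub h2).sub h3).congr_deriv ?_
  field_simp
  rw [hs2]
  ring

theorem continuousOn_primitive_sqrt_div_sub {w : ℝ} (hw : 2 ≤ w) :
    ContinuousOn (fun y => w * Real.arcsin (y / 2) - Real.sqrt (4 - y ^ 2) -
      Real.sqrt (w ^ 2 - 4) * Real.arcsin ((w * y - 4) / (2 * (w - y)))) (Set.Icc (-2) 2) := by
  refine ContinuousOn.sub (by fun_prop) ?_
  rcases hw.eq_or_lt with rfl | hw'
  · norm_num
    exact continuousOn_const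
  refine continuousOn_const.mul (Real.continuous_arcsin.comp_continuousOn ?_)
  refine ContinuousOn.div (by fun_prop) (by fun_prop) fun y hy => ?_
  have := hy.2
  have : 0 < w - y := by linarith
  positivity

theorem intervalIntegrable_sqrt_div_sub {w : ℝ} (hw : 2 ≤ w) :
    IntervalIntegrable (fun y => Real.sqrt (4 - y ^ 2) / (w - y)) volume (-2) 2 := by
  rw [intervalIntegrable_iff_integrableOn_Ioc_of_le (by norm_num)]
  refine intervalIntegral.integrableOn_deriv_of_nonneg (continuousOn_primitive_sqrt_div_sub hw)
    (fun y hy => hasDerivAt_primitive_sqrt_div_sub hw hy) fun y hy => ?_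
  have := hy.2
  exact div_nonneg (Real.sqrt_nonneg _) (by linarith)

/-- The Cauchy transform of the (unnormalised) semicircle law, up to the edge `w = 2`. -/
theorem integral_sqrt_div_sub {w : ℝ} (hw : 2 ≤ w) :
    ∫ y in (-2 : ℝ)..2, Real.sqrt (4 - y ^ 2) / (w - y) =
      Real.pi * (w - Real.sqrt (w ^ 2 - 4)) := by
  rw [intervalIntegral.integral_eq_sub_of_hasDerivAt_of_le (by norm_num)
    (continuousOn_primitive_sqrt_div_sub hw)
    (fun y hy => hasDerivAt_primitive_sqrt_div_sub hw hy) (intervalIntegrable_sqrt_div_sub hw)]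
  rcases hw.eq_or_lt with rfl | hw'
  · norm_num
    ring
  have h1 : (w * 2 - 4) / (2 * (w - 2)) = 1 := by
    rw [div_eq_one_iff_eq (by linarith)]
    ring
  have h2 : (w * (-2) - 4) / (2 * (w - -2)) = -1 := by
    rw [div_eq_iff (by linarith)]
    ring
  rw [h1, h2]
  norm_num
  ring

theorem two_le_add_inv {lam : ℝ} (hlam : 0 < lam) : 2 ≤ lam + 1 / lam := by
  have : lam + 1 / lam - 2 = (lam - 1) ^ 2 / lam := by
    field_simp
    ring
  have : 0 ≤ (lam - 1) ^ 2 / lam := by positivity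
  linarith

theorem muOne_density_nonneg {lam x : ℝ} (hlam : 0 < lam)
    (hx : x ∈ Set.Icc (lam - 2) (lam + 2)) :
    0 ≤ Real.sqrt (4 - (x - lam) ^ 2) / (2 * Real.pi * (lam * x + 1)) := by
  have : 0 ≤ lam * x + 1 := by nlinarith [hx.1, sq_nonneg (lam - 1)]
  positivity

/-- Partial fractions for the density of `muOneAC` against the Cauchy kernel. -/
theorem muOne_density_mul_inv {lam z x : ℝ} (hlam : 0 < lam) (hz : lam + 2 < z)
    (hx : x ∈ Set.Icc (lam - 2) (lam + 2)) :
    Real.sqrt (4 - (x - lam) ^ 2) / (2 * Real.pi * (lam * x + 1)) * (z - x)⁻¹ =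
      1 / (2 * Real.pi * (lam * z + 1)) *
        (Real.sqrt (4 - (x - lam) ^ 2) / ((z - lam) - (x - lam)) +
          Real.sqrt (4 - (lam - x) ^ 2) / ((lam + 1 / lam) - (lam - x))) := by
  have hpi := Real.pi_pos
  have hzx : 0 < z - x := by linarith [hx.2]
  have hz1 : 0 < lam * z + 1 := by
    have : 0 < z := by linarith
    positivity
  have e1 : (z - lam) - (x - lam) = z - x := by ring
  have e2 : (lam + 1 / lam) - (lam - x) = (lam * x + 1) / lam := by
    field_simp
    ring
  rw [e1, e2, show (lam - x) ^ 2 = (x - lam) ^ 2 by ring]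
  rcases (show 0 ≤ lam * x + 1 by nlinarith [hx.1, sq_nonneg (lam - 1)]).eq_or_lt with h | h
  · have hx2 : x = lam - 2 := by nlinarith [hx.1, sq_nonneg (lam - 1)]
    have : 4 - (x - lam) ^ 2 = 0 := by
      rw [hx2]
      ring
    simp [this]
  · have hx1 : x * lam + 1 ≠ 0 := mul_comm lam x ▸ h.ne'
    field_simp
    ring

theorem sqrt_add_inv_sq_sub_four {lam : ℝ} (hlam : 0 < lam) :
    Real.sqrt ((lam + 1 / lam) ^ 2 - 4) = |lam - 1 / lam| := by
  rw [← Real.sqrt_sq_eq_abs]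
  congr 1
  field_simp
  ring

theorem integrableOn_muOne_density_mul_inv {lam z : ℝ} (hlam : 0 < lam) (hz : lam + 2 < z) :
    IntegrableOn (fun x => Real.sqrt (4 - (x - lam) ^ 2) / (2 * Real.pi * (lam * x + 1)) *
      (z - x)⁻¹) (Set.Icc (lam - 2) (lam + 2)) := by
  rw [integrableOn_congr_fun (fun x hx => muOne_density_mul_inv hlam hz hx) measurableSet_Icc,
    integrableOn_Icc_iff_integrableOn_Ioc,
    ← intervalIntegrable_iff_integrableOn_Ioc_of_le (by linarith)]
  refine IntervalIntegrable.const_mul (IntervalIntegrable.add ?_ ?_) _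
  · have := (intervalIntegrable_sqrt_div_sub (w := z - lam) (by linarith)).comp_sub_right lam
    convert this using 1 <;> ring
  · have := ((intervalIntegrable_sqrt_div_sub (two_le_add_inv hlam)).comp_sub_left lam).symm
    convert this using 1; ring

theorem integral_muOne_density_mul_inv {lam z : ℝ} (hlam : 0 < lam) (hz : lam + 2 < z) :
    ∫ x in Set.Icc (lam - 2) (lam + 2),
      Real.sqrt (4 - (x - lam) ^ 2) / (2 * Real.pi * (lam * x + 1)) * (z - x)⁻¹ =
      (z - lam - Real.sqrt ((z - lam) ^ 2 - 4) + (lam + 1 / lam - |lam - 1 / lam|)) /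
        (2 * (lam * z + 1)) := by
  rw [setIntegral_congr_fun measurableSet_Icc
      (fun x hx => muOne_density_mul_inv hlam hz hx),
    integral_Icc_eq_integral_Ioc, ← intervalIntegral.integral_of_le (by linarith),
    intervalIntegral.integral_const_mul, intervalIntegral.integral_add]
  · rw [intervalIntegral.integral_comp_sub_right
        (fun y => Real.sqrt (4 - y ^ 2) / ((z - lam) - y)) lam,
      intervalIntegral.integral_comp_sub_left
        (fun y => Real.sqrt (4 - y ^ 2) / ((lam + 1 / lam) - y)) lam,
      show lam - 2 - lam = -2 by ring, show lam + 2 - lam = 2 by ring,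
      show lam - (lam + 2) = -2 by ring, show lam - (lam - 2) = 2 by ring,
      integral_sqrt_div_sub (by linarith), integral_sqrt_div_sub (two_le_add_inv hlam),
      sqrt_add_inv_sq_sub_four hlam]
    have hpi := Real.pi_pos
    have hz1 : 0 < lam * z + 1 := by
      have : 0 < z := by linarith
      positivity
    generalize |lam - 1 / lam| = t
    field_simp
  · have := (intervalIntegrable_sqrt_div_sub (w := z - lam) (by linarith)).comp_sub_right lam
    convert this using 1 <;> ring
  · have := ((intervalIntegrable_sqrt_div_sub (two_le_add_inv hlam)).comp_sub_left lam).symm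
    convert this using 1; ring

open Classical in
theorem measurable_muOneAC_density (lam : ℝ) :
    Measurable fun x : ℝ => ENNReal.ofReal (if x ∈ Set.Icc (lam - 2) (lam + 2) then
      Real.sqrt (4 - (x - lam) ^ 2) / (2 * Real.pi * (lam * x + 1)) else 0) := by
  refine ENNReal.measurable_ofReal.comp (Measurable.ite measurableSet_Icc ?_ measurable_const)
  fun_prop

open Classical in
theorem toReal_muOneAC_density_smul {lam : ℝ} (hlam : 0 < lam) (g : ℝ → ℝ) :
    (fun x : ℝ => (ENNReal.ofReal (if x ∈ Set.Icc (lam - 2) (lam + 2) then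
      Real.sqrt (4 - (x - lam) ^ 2) / (2 * Real.pi * (lam * x + 1)) else 0)).toReal • g x) =
    (Set.Icc (lam - 2) (lam + 2)).indicator fun x =>
      Real.sqrt (4 - (x - lam) ^ 2) / (2 * Real.pi * (lam * x + 1)) * g x := by
  funext x
  by_cases hx : x ∈ Set.Icc (lam - 2) (lam + 2)
  · rw [if_pos hx, Set.indicator_of_mem hx, ENNReal.toReal_ofReal (muOne_density_nonneg hlam hx),
      smul_eq_mul]
  · rw [if_neg hx, Set.indicator_of_notMem hx]
    simp

theorem integrable_inv_sub_muOneAC {lam z : ℝ} (hlam : 0 < lam) (hz : lam + 2 < z) :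
    Integrable (fun x => (z - x)⁻¹) (muOneAC lam) := by
  rw [muOneAC, integrable_withDensity_iff_integrable_smul' (measurable_muOneAC_density lam)
    (Filter.Eventually.of_forall fun _ => ENNReal.ofReal_lt_top),
    toReal_muOneAC_density_smul hlam, integrable_indicator_iff measurableSet_Icc]
  exact integrableOn_muOne_density_mul_inv hlam hz

theorem integral_inv_sub_muOneAC {lam z : ℝ} (hlam : 0 < lam) (hz : lam + 2 < z) :
    ∫ x, (z - x)⁻¹ ∂(muOneAC lam) =
      (z - lam - Real.sqrt ((z - lam) ^ 2 - 4) + (lam + 1 / lam - |lam - 1 / lam|)) /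
        (2 * (lam * z + 1)) := by
  rw [muOneAC, integral_withDensity_eq_integral_toReal_smul (measurable_muOneAC_density lam)
    (Filter.Eventually.of_forall fun _ => ENNReal.ofReal_lt_top),
    toReal_muOneAC_density_smul hlam, integral_indicator measurableSet_Icc]
  exact integral_muOne_density_mul_inv hlam hz

theorem stmt3 (lam : ℝ) (hlam : 0 < lam) (z : ℝ) (hz : lam + 2 < z) :
    (∫ x, (z - x)⁻¹ ∂(muOne lam)) =
      (z + lam - Real.sqrt ((z - lam) ^ 2 - 4)) / (2 * (lam * z + 1)) := by
  have hz1 : 0 < lam * z + 1 := by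
    have : 0 < z := by linarith
    positivity
  have hd : Integrable (fun x => (z - x)⁻¹) (Measure.dirac (-(1 / lam))) :=
    integrable_dirac (by simp)
  rw [muOne, integral_add_measure (hd.smul_measure ENNReal.ofReal_ne_top)
    (integrable_inv_sub_muOneAC hlam hz), integral_smul_measure, integral_dirac,
    integral_inv_sub_muOneAC hlam hz, ENNReal.toReal_ofReal (le_max_left _ _), smul_eq_mul,
    show z - -(1 / lam) = (lam * z + 1) / lam by field_simp; ring]
  rcases le_total lam 1 with h | h
  · have h1 : 1 ≤ 1 / lam := by rwa [le_div_iff₀ hlam, one_mul]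
    have h2 : 1 ≤ 1 / lam ^ 2 := by
      rw [le_div_iff₀ (by positivity)]
      nlinarith
    rw [max_eq_left (by linarith), abs_of_nonpos (by linarith)]
    ring
  · have h1 : 1 / lam ≤ 1 := by rwa [div_le_iff₀ hlam, one_mul]
    have h2 : 1 / lam ^ 2 ≤ 1 := by
      rw [div_le_iff₀ (by positivity)]
      nlinarith
    rw [max_eq_right (by linarith), abs_of_nonneg (by linarith)]
    field_simp
    ring
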